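/- Let m > c ≥ 1 be integers and let α ∈ [0,1). Let B = (1−α) I_m + α J_m ∈ ℝ^{m×m}, where J_m is the m×m all-ones matrix, and let C ∈ ℝ^{m×c} consist of the first c columns of B. Then ‖B − C (C⁺ B (C⁺)ᵀ) Cᵀ‖_F² = (m − c)(1 − α)² · N / D², where D = α²cm + α² − 2α²c + 2αc − 2α + 1 and N = α⁴c²m² − 4α⁴c²m + 4α⁴c² + 2α⁴cm² − 4α⁴cm + α⁴c + α⁴m − α⁴ + 4α³c²m − 8α³c² + 2α³cm + 2α³c − 2α³m + 2α³ + 4α²c² + 2α²cm − 7α²c + α²m + 4αc − 2α + 1. -/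

import Mathlib

open Matrix

/-- `P` is the Moore–Penrose pseudoinverse of `M`. -/
def IsMoorePenrose {m n : Type*} [Fintype m] [Fintype n]
    (M : Matrix m n ℝ) (P : Matrix n m ℝ) : Prop :=
  M * P * M = M ∧ P * M * P = P ∧ (M * P)ᵀ = M * P ∧ (P * M)ᵀ = P * M

/-- The squared Frobenius norm of a real matrix. -/
noncomputable def frobSq {m n : Type*} [Fintype m] [Fintype n]
    (M : Matrix m n ℝ) : ℝ :=
  ∑ i, ∑ j, (M i j) ^ 2

/-- `M * P` is the only symmetric matrix of the form `M * Y` that fixes `M` on the left. -/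
theorem IsMoorePenrose.mul_eq_of_fixes {m n : Type*} [Fintype m] [Fintype n]
    {M : Matrix m n ℝ} {P : Matrix n m ℝ} (h : IsMoorePenrose M P)
    {Q : Matrix m m ℝ} {Y : Matrix n m ℝ} (hY : M * Y = Q) (hQ : Qᵀ = Q) (hQM : Q * M = M) :
    M * P = Q := by
  obtain ⟨h1, -, h3, -⟩ := h
  calc M * P = (Q * (M * P))ᵀ := by rw [← Matrix.mul_assoc, hQM, h3]
    _ = M * P * M * Y := by rw [Matrix.transpose_mul, h3, hQ, ← hY, ← Matrix.mul_assoc]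
    _ = Q := by rw [h1, hY]

theorem IsMoorePenrose.submatrix {m n k : Type*} [Fintype m] [Fintype n] [Fintype k]
    {M : Matrix m n ℝ} {P : Matrix n m ℝ} (h : IsMoorePenrose M P) (e : k ≃ m) :
    IsMoorePenrose (M.submatrix e id) (P.submatrix id e) := by
  obtain ⟨h1, h2, h3, h4⟩ := h
  have hMP : M.submatrix e id * P.submatrix id e = (M * P).submatrix e e :=
    (Matrix.submatrix_mul M P e id e Function.bijective_id).symm
  have hPM : P.submatrix id e * M.submatrix e id = P * M := by
    rw [Matrix.submatrix_mul_equiv P M id e id, Matrix.submatrix_id_id]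
  refine ⟨?_, ?_, ?_, ?_⟩
  · rw [hMP, Matrix.submatrix_mul_equiv, h1]
  · rw [hPM, ← Matrix.submatrix_id_id (P * M),
      ← Matrix.submatrix_mul _ _ id id e Function.bijective_id, h2]
  · rw [hMP, Matrix.transpose_submatrix, h3]
  · rw [hPM, h4]

theorem frobSq_submatrix_equiv {m n : Type*} [Fintype m] [Fintype n] (M : Matrix m m ℝ)
    (e : n ≃ m) : frobSq (M.submatrix e e) = frobSq M := by
  unfold frobSq
  rw [← e.sum_comp]
  exact Finset.sum_congr rfl fun i _ => e.sum_comp fun j => M (e i) j ^ 2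

/-- The squared Frobenius norm of a matrix with blocks `p J`, `q J`, `q J`, `s 1 + r J`. -/
theorem frobSq_fromBlocks_const (n l : Type*) [Fintype n] [Fintype l] [DecidableEq l]
    (p q r s : ℝ) :
    frobSq (Matrix.fromBlocks (Matrix.of fun (_ _ : n) => p) (Matrix.of fun (_ : n) (_ : l) => q)
      (Matrix.of fun (_ : l) (_ : n) => q)
      (Matrix.of fun (i j : l) => s * (1 : Matrix l l ℝ) i j + r)) =
    (Fintype.card n : ℝ) ^ 2 * p ^ 2 + 2 * Fintype.card n * Fintype.card l * q ^ 2 +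
      (Fintype.card l : ℝ) ^ 2 * r ^ 2 + 2 * Fintype.card l * s * r + Fintype.card l * s ^ 2 := by
  simp [frobSq, Matrix.one_apply, add_sq, Finset.sum_add_distrib, ite_pow]
  ring

section Blocks

variable (n l : Type*) [Fintype n] [Fintype l] (α : ℝ)

/-- The common denominator of the entries of `onesProj`: `|n|` times it is the squared length of
the vector equal to `1 - α + α |n|` on `n` and to `α |n|` on `l`. -/
noncomputable def onesDenom : ℝ :=
  (1 - α + α * Fintype.card n) ^ 2 + α ^ 2 * Fintype.card n * Fintype.card l

theorem onesDenom_pos {α : ℝ} (hα0 : 0 ≤ α) (hα1 : α < 1) : 0 < onesDenom n l α := by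
  have : 0 < 1 - α := sub_pos.2 hα1
  unfold onesDenom
  positivity

variable [DecidableEq n]

/-- The orthogonal projection onto the range of `onesCols`. -/
noncomputable def onesProj : Matrix (n ⊕ l) (n ⊕ l) ℝ :=
  Matrix.fromBlocks
    (Matrix.of fun i j => (1 : Matrix n n ℝ) i j - α ^ 2 * Fintype.card l / onesDenom n l α)
    (Matrix.of fun _ _ => α * (1 - α + α * Fintype.card n) / onesDenom n l α)
    (Matrix.of fun _ _ => α * (1 - α + α * Fintype.card n) / onesDenom n l α)
    (Matrix.of fun _ _ => α ^ 2 * Fintype.card n / onesDenom n l α)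

/-- A matrix `Y` with `onesCols * Y = onesProj`. -/
noncomputable def onesPinv : Matrix n (n ⊕ l) ℝ :=
  Matrix.of fun i => Sum.elim
    (fun j => (1 : Matrix n n ℝ) i j / (1 - α) - α * (1 - α + α * Fintype.card n +
      α * Fintype.card l) / ((1 - α) * onesDenom n l α))
    (fun _ => α / onesDenom n l α)

theorem onesProj_transpose : (onesProj n l α)ᵀ = onesProj n l α := by
  unfold onesProj
  rw [Matrix.fromBlocks_transpose]
  congr 1
  ext i j
  simp [Matrix.one_apply, eq_comm]

/-- The row sums of `onesProj`. -/
theorem onesProj_mulVec_one {α : ℝ} (hα0 : 0 ≤ α) (hα1 : α < 1) :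
    onesProj n l α *ᵥ 1 = Sum.elim
      (fun _ => (1 - α + α * Fintype.card n) * (1 - α + α * Fintype.card n +
        α * Fintype.card l) / onesDenom n l α)
      (fun _ => α * Fintype.card n * (1 - α + α * Fintype.card n +
        α * Fintype.card l) / onesDenom n l α) := by
  have hD := (onesDenom_pos n l hα0 hα1).ne'
  ext (i | i) <;>
  simp [onesProj, Matrix.mulVec, dotProduct, Matrix.one_apply, Finset.sum_sub_distrib]
  · field_simp
    simp only [onesDenom]
    ring
  · field_simp

variable [DecidableEq l]

/-- The first block column of `(1 - α) • 1 + α • J`. -/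
def onesCols : Matrix (n ⊕ l) n ℝ :=
  Matrix.of fun i j => (1 - α) * (1 : Matrix (n ⊕ l) (n ⊕ l) ℝ) i (Sum.inl j) + α

variable {α}

theorem onesCols_mul_onesPinv (hα0 : 0 ≤ α) (hα1 : α < 1) :
    onesCols n l α * onesPinv n l α = onesProj n l α := by
  have hD := (onesDenom_pos n l hα0 hα1).ne'
  have hβ : 1 - α ≠ 0 := (sub_pos.2 hα1).ne'
  ext (i | i) (j | j) <;>
  simp [onesCols, onesPinv, onesProj, Matrix.mul_apply, Matrix.one_apply, add_mul, mul_sub,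
    Finset.sum_add_distrib, Finset.sum_sub_distrib, ite_div] <;>
  field_simp <;> simp only [onesDenom] <;> ring

theorem onesProj_mul_onesCols (hα0 : 0 ≤ α) (hα1 : α < 1) :
    onesProj n l α * onesCols n l α = onesCols n l α := by
  have hD := (onesDenom_pos n l hα0 hα1).ne'
  ext (i | i) j <;>
  simp [onesCols, onesProj, Matrix.mul_apply, Matrix.one_apply, mul_add, sub_mul,
    Finset.sum_add_distrib, Finset.sum_sub_distrib] <;>
  field_simp <;> simp only [onesDenom] <;> ring

theorem onesProj_mul_self (hα0 : 0 ≤ α) (hα1 : α < 1) :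
    onesProj n l α * onesProj n l α = onesProj n l α := by
  rw [← onesCols_mul_onesPinv n l hα0 hα1, ← Matrix.mul_assoc,
    onesCols_mul_onesPinv n l hα0 hα1, onesProj_mul_onesCols n l hα0 hα1,
    onesCols_mul_onesPinv n l hα0 hα1]

theorem frobSq_sub_onesProj (hα0 : 0 ≤ α) (hα1 : α < 1) (B : Matrix (n ⊕ l) (n ⊕ l) ℝ)
    (hB : B = (1 - α) • (1 : Matrix (n ⊕ l) (n ⊕ l) ℝ) + α • Matrix.of (fun _ _ => (1 : ℝ)))
    (c m D : ℝ) (hc : c = Fintype.card n) (hm : m = c + Fintype.card l)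
    (hD : D = α ^ 2 * c * m + α ^ 2 - 2 * α ^ 2 * c + 2 * α * c - 2 * α + 1) :
    frobSq (B - onesProj n l α * B * onesProj n l α) =
      (m - c) * (1 - α) ^ 2 * (α ^ 4 * c ^ 2 * m ^ 2 - 4 * α ^ 4 * c ^ 2 * m + 4 * α ^ 4 * c ^ 2
            + 2 * α ^ 4 * c * m ^ 2 - 4 * α ^ 4 * c * m + α ^ 4 * c + α ^ 4 * m
            - α ^ 4 + 4 * α ^ 3 * c ^ 2 * m - 8 * α ^ 3 * c ^ 2
            + 2 * α ^ 3 * c * m + 2 * α ^ 3 * c - 2 * α ^ 3 * m + 2 * α ^ 3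
            + 4 * α ^ 2 * c ^ 2 + 2 * α ^ 2 * c * m - 7 * α ^ 2 * c
            + α ^ 2 * m + 4 * α * c - 2 * α + 1) / D ^ 2 := by
  have hJ : (Matrix.of fun _ _ => 1 : Matrix (n ⊕ l) (n ⊕ l) ℝ) = Matrix.vecMulVec 1 1 := by
    ext; simp [Matrix.vecMulVec_apply]
  have hDD : onesDenom n l α = D := by
    rw [hD, hm, hc, onesDenom]; ring
  have hD0 : D ≠ 0 := hDD ▸ (onesDenom_pos n l hα0 hα1).ne'
  have hPBP : onesProj n l α * B * onesProj n l α = (1 - α) • onesProj n l α +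
      α • Matrix.vecMulVec (onesProj n l α *ᵥ 1) (onesProj n l α *ᵥ 1) := by
    have hv : (1 : n ⊕ l → ℝ) ᵥ* onesProj n l α = onesProj n l α *ᵥ 1 := by
      rw [← Matrix.mulVec_transpose, onesProj_transpose]
    rw [hB, hJ, Matrix.mul_add, Matrix.add_mul, Matrix.mul_smul, Matrix.mul_smul,
      Matrix.smul_mul, Matrix.smul_mul, Matrix.mul_one, onesProj_mul_self n l hα0 hα1,
      Matrix.mul_vecMulVec, Matrix.vecMulVec_mul, hv]
  set d : ℝ := (Fintype.card l : ℝ) with hd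
  have hE : B - onesProj n l α * B * onesProj n l α = Matrix.fromBlocks
      (Matrix.of fun _ _ => α + (1 - α) * α ^ 2 * d / D -
        α * ((1 - α + α * c) * (1 - α + α * c + α * d) / D) ^ 2)
      (Matrix.of fun _ _ => α - (1 - α) * (α * (1 - α + α * c)) / D -
        α * ((1 - α + α * c) * (1 - α + α * c + α * d) / D) *
          (α * c * (1 - α + α * c + α * d) / D))
      (Matrix.of fun _ _ => α - (1 - α) * (α * (1 - α + α * c)) / D -
        α * ((1 - α + α * c) * (1 - α + α * c + α * d) / D) *
          (α * c * (1 - α + α * c + α * d) / D))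
      (Matrix.of fun i j => (1 - α) * (1 : Matrix l l ℝ) i j + (α - (1 - α) * α ^ 2 * c / D -
        α * (α * c * (1 - α + α * c + α * d) / D) ^ 2)) := by
    rw [hPBP, onesProj_mulVec_one n l hα0 hα1, hB, hDD, ← hc, ← hd]
    ext (i | i) (j | j) <;>
    simp [onesProj, Matrix.vecMulVec_apply, Matrix.one_apply, hDD, ← hc, ← hd] <;>
    (try split_ifs) <;> ring
  rw [hE, frobSq_fromBlocks_const, ← hc, ← hd]
  field_simp
  rw [hD, hm]
  ring

end Blocks

/-- Exact error of the modified Nyström approximation of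
`B = (1−α) I_m + α J_m` built from its first `c` columns. -/
theorem modified_nystrom_error_ones_matrix (m c : ℕ) (hc : 1 ≤ c) (hcm : c < m)
    (α : ℝ) (hα0 : 0 ≤ α) (hα1 : α < 1)
    (B : Matrix (Fin m) (Fin m) ℝ)
    (hB : B = (1 - α) • (1 : Matrix (Fin m) (Fin m) ℝ) +
            α • Matrix.of (fun _ _ => (1 : ℝ)))
    (C : Matrix (Fin m) (Fin c) ℝ)
    (hC : C = B.submatrix id (fun j : Fin c => Fin.castLE hcm.le j))
    (Cp : Matrix (Fin c) (Fin m) ℝ) (hCp : IsMoorePenrose C Cp)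
    (D N : ℝ)
    (hD : D = α ^ 2 * c * m + α ^ 2 - 2 * α ^ 2 * c + 2 * α * c - 2 * α + 1)
    (hN : N = α ^ 4 * c ^ 2 * m ^ 2 - 4 * α ^ 4 * c ^ 2 * m + 4 * α ^ 4 * c ^ 2
            + 2 * α ^ 4 * c * m ^ 2 - 4 * α ^ 4 * c * m + α ^ 4 * c + α ^ 4 * m
            - α ^ 4 + 4 * α ^ 3 * c ^ 2 * m - 8 * α ^ 3 * c ^ 2
            + 2 * α ^ 3 * c * m + 2 * α ^ 3 * c - 2 * α ^ 3 * m + 2 * α ^ 3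
            + 4 * α ^ 2 * c ^ 2 + 2 * α ^ 2 * c * m - 7 * α ^ 2 * c
            + α ^ 2 * m + 4 * α * c - 2 * α + 1) :
    frobSq (B - C * (Cp * B * Cpᵀ) * Cᵀ) =
      ((m : ℝ) - c) * (1 - α) ^ 2 * N / D ^ 2 := by
  subst hN
  obtain ⟨d, rfl⟩ := Nat.exists_eq_add_of_le hcm.le
  let e : Fin c ⊕ Fin d ≃ Fin (c + d) := finSumFinEquiv
  have hBe : B.submatrix e e = (1 - α) • (1 : Matrix (Fin c ⊕ Fin d) (Fin c ⊕ Fin d) ℝ) +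
      α • Matrix.of (fun _ _ => (1 : ℝ)) := by
    ext i j
    simp [hB, Matrix.one_apply]
  have hCe : C.submatrix e id = onesCols (Fin c) (Fin d) α := by
    ext i j
    have hj : Fin.castLE hcm.le j = e (Sum.inl j) := rfl
    simp [hC, hB, hj, onesCols, Matrix.one_apply]
  have hP := (hCe ▸ hCp.submatrix e).mul_eq_of_fixes
    (onesCols_mul_onesPinv (Fin c) (Fin d) hα0 hα1) (onesProj_transpose _ _ _)
    (onesProj_mul_onesCols _ _ hα0 hα1)
  have hPe : (C * Cp).submatrix e e = onesProj (Fin c) (Fin d) α := by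
    rw [Matrix.submatrix_mul C Cp e id e Function.bijective_id, hCe, hP]
  have hCC : C * (Cp * B * Cpᵀ) * Cᵀ = C * Cp * B * (C * Cp) := by
    nth_rewrite 2 [← hCp.2.2.1]
    simp only [Matrix.transpose_mul, Matrix.mul_assoc]
  have hsub : (B - C * Cp * B * (C * Cp)).submatrix e e =
      B.submatrix e e - (C * Cp * B * (C * Cp)).submatrix e e := rfl
  rw [← frobSq_submatrix_equiv _ e, hCC, hsub,
    ← Matrix.submatrix_mul_equiv _ _ e e e, ← Matrix.submatrix_mul_equiv _ _ e e e, hPe]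
  exact frobSq_sub_onesProj (Fin c) (Fin d) hα0 hα1 _ hBe c _ D (by simp) (by simp) hD
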